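/- (Recursion step, flipping case.) Let n be a natural number, c ∈ ZMod 2, and y' : Fin (2n+1) → ZMod 2 with y' ≠ 0. Let y : Fin (2n+3) → ZMod 2 be the string obtained by prepending two 1's to y' (i.e., y = Fin.cons 1 (Fin.cons 1 y')). Then card {x : Fin (2n+3) → ZMod 2 | C(x) = c ∧ x·y = c} = 3 · 2^(2n) − 2 · card {x' : Fin (2n+1) → ZMod 2 | C(x') = c ∧ x'·y' = c}. -/

import Mathlib

/-- The number of '11' pairs starting at even positions among the first `2n` bits. -/
def numOnesPairs {n : ℕ} (x : Fin (2 * n + 1) → ZMod 2) : ℕ :=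
  (Finset.univ.filter (fun i : Fin n =>
    x ⟨2 * (i : ℕ), by have := i.isLt; omega⟩ = 1 ∧
    x ⟨2 * (i : ℕ) + 1, by have := i.isLt; omega⟩ = 1)).card

/-- The bit encoded by a string of odd length `2n+1`. -/
def encBit {n : ℕ} (x : Fin (2 * n + 1) → ZMod 2) : ZMod 2 :=
  (numOnesPairs x : ZMod 2) + x ⟨2 * n, by omega⟩

/-- Inner product of bitstrings, modulo 2. -/
def ip {m : ℕ} (x y : Fin m → ZMod 2) : ZMod 2 := ∑ i, x i * y i

/-- A bit-valued function that some translation complements takes each value equally often. -/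
lemma two_mul_card_filter_eq {m : ℕ} (f : (Fin m → ZMod 2) → ZMod 2) (v : Fin m → ZMod 2)
    (hf : ∀ x, f (x + v) = f x + 1) (c : ZMod 2) :
    2 * (Finset.univ.filter (fun x => f x = c)).card = 2 ^ m := by
  have hflip : (Finset.univ.filter (fun x => f x = c)).card =
      (Finset.univ.filter (fun x => ¬ f x = c)).card := by
    refine Finset.card_equiv (Equiv.addRight v) fun x => ?_
    simp only [Finset.mem_filter, Finset.mem_univ, true_and, Equiv.coe_addRight, hf]
    generalize f x = a
    revert a c
    decide
  have htotal := Finset.card_filter_add_card_filter_not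
    (s := (Finset.univ : Finset (Fin m → ZMod 2))) (fun x => f x = c)
  rw [← hflip, Finset.card_univ, Fintype.card_fun, ZMod.card, Fintype.card_fin] at htotal
  omega

lemma card_filter_eq_and_add {α : Type*} [Fintype α] (f g : α → ZMod 2) (c d : ZMod 2) :
    (Finset.univ.filter (fun x => f x = c ∧ g x = d)).card +
      (Finset.univ.filter (fun x => f x = c ∧ g x = d + 1)).card =
      (Finset.univ.filter (fun x => f x = c)).card := by
  rw [← Finset.card_filter_add_card_filter_not (s := Finset.univ.filter (fun x => f x = c))
    (fun x => g x = d), Finset.filter_filter, Finset.filter_filter]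
  have hne : ∀ a b : ZMod 2, a = b + 1 ↔ ¬ a = b := by decide
  simp only [hne]

/-- Counting bitstrings according to their first bit. -/
lemma card_filter_fin_cons {m : ℕ} (p : (Fin (m + 1) → ZMod 2) → Prop) [DecidablePred p] :
    (Finset.univ.filter p).card =
      (Finset.univ.filter (fun x : Fin m → ZMod 2 => p (Fin.cons 0 x))).card +
        (Finset.univ.filter (fun x : Fin m → ZMod 2 => p (Fin.cons 1 x))).card := by
  simp only [Finset.card_filter]
  rw [← (Fin.consEquiv (fun _ : Fin (m + 1) => ZMod 2)).sum_comp, Fintype.sum_prod_type]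
  exact Fin.sum_univ_two _

lemma ip_add_left {m : ℕ} (x v y : Fin m → ZMod 2) : ip (x + v) y = ip x y + ip v y := by
  simp [ip, add_mul, Finset.sum_add_distrib]

lemma ip_single {m : ℕ} (i : Fin m) (y : Fin m → ZMod 2) : ip (Pi.single i 1) y = y i := by
  simp [ip, Pi.single_apply]

lemma ip_cons {m : ℕ} (a b : ZMod 2) (x y : Fin m → ZMod 2) :
    ip (Fin.cons a x : Fin (m + 1) → ZMod 2) (Fin.cons b y) = a * b + ip x y := by
  simp [ip, Fin.sum_univ_succ]

lemma encBit_add_single_last {n : ℕ} (x : Fin (2 * n + 1) → ZMod 2) :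
    encBit (x + Pi.single (Fin.last (2 * n)) 1) = encBit x + 1 := by
  have hpairs : numOnesPairs (x + Pi.single (Fin.last (2 * n)) 1) = numOnesPairs x := by
    unfold numOnesPairs
    congr 1
    refine Finset.filter_congr fun i _ => ?_
    have hi := i.isLt
    have h₀ : (2 * (i : ℕ)) ≠ 2 * n := by omega
    have h₁ : (2 * (i : ℕ) + 1) ≠ 2 * n := by omega
    simp only [Pi.add_apply, Pi.single_apply, Fin.ext_iff, Fin.val_last, h₀, h₁, if_false, add_zero]
  unfold encBit
  rw [hpairs]
  simp [Pi.single_apply, Fin.ext_iff, add_assoc]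

lemma encBit_cons_cons {n : ℕ} (a b : ZMod 2) (x : Fin (2 * n + 1) → ZMod 2) :
    encBit (n := n + 1) (Fin.cons a (Fin.cons b x : Fin (2 * n + 1 + 1) → ZMod 2)) =
      a * b + encBit x := by
  have hpairs : numOnesPairs (n := n + 1)
      (Fin.cons a (Fin.cons b x : Fin (2 * n + 1 + 1) → ZMod 2)) =
      (if a = 1 ∧ b = 1 then 1 else 0) + numOnesPairs x := by
    unfold numOnesPairs
    rw [Finset.card_filter, Finset.card_filter, Fin.sum_univ_succ]
    rfl
  have hmul : ∀ a b : ZMod 2, ((if a = 1 ∧ b = 1 then 1 else 0 : ℕ) : ZMod 2) = a * b := by decide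
  unfold encBit
  rw [hpairs, Nat.cast_add, hmul, add_assoc]
  rfl

theorem recursion_step_flipping (n : ℕ) (c : ZMod 2)
    (y' : Fin (2 * n + 1) → ZMod 2) (hy' : y' ≠ 0)
    (y : Fin (2 * (n + 1) + 1) → ZMod 2)
    (hy : y = Fin.cons 1 (Fin.cons 1 y') ∘ Fin.cast (by omega)) :
    ((Finset.univ.filter
        (fun x : Fin (2 * (n + 1) + 1) → ZMod 2 => encBit x = c ∧ ip x y = c)).card : ℤ)
      = 3 * 2 ^ (2 * n) - 2 *
        ((Finset.univ.filter
          (fun x' : Fin (2 * n + 1) → ZMod 2 => encBit x' = c ∧ ip x' y' = c)).card : ℤ) := by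
  obtain ⟨i, hi⟩ := Function.ne_iff.mp hy'
  have hyi : y' i = 1 := (by decide : ∀ a : ZMod 2, a ≠ 0 → a = 1) _ hi
  have hE := two_mul_card_filter_eq encBit _ (encBit_add_single_last (n := n)) c
  have hI := two_mul_card_filter_eq (fun x => ip x y') (Pi.single i 1)
    (fun x => by rw [ip_add_left, ip_single, hyi]) c
  have hEsplit := card_filter_eq_and_add encBit (fun x => ip x y') c c
  have hIsplit := card_filter_eq_and_add (fun x => ip x y') encBit c c
  have hy_cons : y = (Fin.cons 1 (Fin.cons 1 y' : Fin (2 * n + 1 + 1) → ZMod 2) :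
      Fin (2 * n + 1 + 1 + 1) → ZMod 2) := hy
  have hshift : ∀ a b : ZMod 2, 1 + a = b ↔ a = b + 1 := by decide
  have hcount : (Finset.univ.filter
      (fun x : Fin (2 * (n + 1) + 1) → ZMod 2 => encBit x = c ∧ ip x y = c)).card =
      (Finset.univ.filter (fun x => encBit x = c ∧ ip x y' = c)).card +
      (Finset.univ.filter (fun x => encBit x = c ∧ ip x y' = c + 1)).card +
      ((Finset.univ.filter (fun x => encBit x = c ∧ ip x y' = c + 1)).card +
      (Finset.univ.filter (fun x => encBit x = c + 1 ∧ ip x y' = c)).card) := by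
    subst hy_cons
    refine (card_filter_fin_cons (m := 2 * n + 1 + 1) _).trans ?_
    rw [card_filter_fin_cons (m := 2 * n + 1), card_filter_fin_cons (m := 2 * n + 1)]
    have hcancel : ∀ a : ZMod 2, 1 + (1 + a) = a := by decide
    simp only [encBit_cons_cons, ip_cons, mul_one, mul_zero, zero_add, hcancel, hshift]
  simp only [and_comm (b := encBit _ = _)] at hIsplit
  rw [hcount]
  have hpow : 2 ^ (2 * n + 1) = 2 * 2 ^ (2 * n) := pow_succ' 2 (2 * n)
  rw [hpow] at hE hI
  have hpow_cast : ((2 ^ (2 * n) : ℕ) : ℤ) = 2 ^ (2 * n) := by push_cast; rfl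
  rw [← hpow_cast]
  omega
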